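/- Let B = {z ∈ ℂ : |z| < 1} be the open unit disk, let K ⊆ B be a finite set with exactly n elements, and let u ∈ B ∖ K. Then the fundamental group π₁(B ∖ K, u) is isomorphic to the free group on n generators. -/

import Mathlib

open CategoryTheory Set

section Groupoid

variable {X : Type*} [TopologicalSpace X]

/-- Induction principle: a property of homotopy classes of paths which is stable under
concatenation and holds for the paths lying in a member of an open cover always holds. -/
theorem Path.Homotopic.Quotient.induction_of_open_cover {κ : Type*} {c : κ → Set X}
    (hc : ∀ i, IsOpen (c i)) (hcov : ∀ x, ∃ i, x ∈ c i)
    {P : ∀ x y : X, Path.Homotopic.Quotient x y → Prop}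
    (htrans : ∀ {x y z : X} {p : Path.Homotopic.Quotient x y} {q : Path.Homotopic.Quotient y z},
      P x y p → P y z q → P x z (p.trans q))
    (hpath : ∀ (i : κ) {x y : X} (p : Path x y), (∀ t, p t ∈ c i) → P x y (.mk p))
    {x y : X} (q : Path.Homotopic.Quotient x y) : P x y q := by
  obtain ⟨p, rfl⟩ := Path.Homotopic.Quotient.mk_surjective q
  obtain ⟨t, ht0, hmono, ⟨N, hN⟩, hsub⟩ := exists_monotone_Icc_subset_open_cover_unitInterval
    (c := fun i => p ⁻¹' c i) (fun i => (hc i).preimage p.continuous)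
    (fun s _ => mem_iUnion.2 (hcov (p s)))
  have key : ∀ n, P _ _ (.mk (p.subpath (t 0) (t n))) := by
    intro n
    induction n with
    | zero =>
      obtain ⟨i, hi⟩ := hcov (p (t 0))
      refine hpath i _ fun s => ?_
      rw [Path.subpath_self]
      exact hi
    | succ n ih =>
      obtain ⟨i, hi⟩ := hsub n
      have h2 : P _ _ (.mk (p.subpath (t n) (t (n + 1)))) := by
        refine hpath i _ fun s => ?_
        have hs := mem_range_self (f := p.subpath (t n) (t (n + 1))) s
        rw [Path.range_subpath_of_le _ _ _ (hmono n.le_succ)] at hs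
        obtain ⟨r, hr, hrs⟩ := hs
        exact hrs ▸ hi hr
      have h3 := htrans ih h2
      rwa [← Path.Homotopic.Quotient.mk_trans,
        Path.Homotopic.Quotient.eq.2 ⟨Path.Homotopy.subpathTransSubpath p _ _ _⟩] at h3
  have h1 := key N
  rw [ht0, hN N le_rfl, Path.subpath_zero_one] at h1
  have aux : ∀ {a b : X} (ha : a = x) (hb : b = y),
      P a b (.mk (p.cast ha hb)) → P x y (.mk p) := by
    rintro _ _ rfl rfl h
    exact h
  exact aux _ _ h1

namespace IsSimplyConnected

variable {U : Set X} (hU : IsSimplyConnected U) {x y z : X}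

/-- The homotopy class of the paths from `x` to `y` inside a simply connected set. -/
noncomputable def arrow (hx : x ∈ U) (hy : y ∈ U) :
    FundamentalGroupoid.mk x ⟶ FundamentalGroupoid.mk y :=
  Path.Homotopic.Quotient.mk (hU.isPathConnected.joinedIn x hx y hy).somePath

theorem arrow_eq (hx : x ∈ U) (hy : y ∈ U) (p : Path x y) (hp : ∀ t, p t ∈ U) :
    hU.arrow hx hy = Path.Homotopic.Quotient.mk p := by
  have := hU.simplyConnectedSpace
  have lift : ∀ q : Path x y, (∀ t, q t ∈ U) →
      ∃ r : Path (⟨x, hx⟩ : U) ⟨y, hy⟩, r.map continuous_subtype_val = q := fun q hq =>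
    ⟨{ toFun := fun t => ⟨q t, hq t⟩
       source' := by simp
       target' := by simp }, by ext; rfl⟩
  obtain ⟨r, hr⟩ := lift p hp
  obtain ⟨s, hs⟩ := lift _ (hU.isPathConnected.joinedIn x hx y hy).somePath_mem
  rw [arrow, ← hr, ← hs, Path.Homotopic.Quotient.eq]
  exact (SimplyConnectedSpace.paths_homotopic s r).map ⟨_, continuous_subtype_val⟩

theorem arrow_self (hx : x ∈ U) : hU.arrow hx hx = 𝟙 _ :=
  hU.arrow_eq hx hx (Path.refl x) fun _ => hx

theorem arrow_comp (hx : x ∈ U) (hy : y ∈ U) (hz : z ∈ U) :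
    hU.arrow hx hy ≫ hU.arrow hy hz = hU.arrow hx hz := by
  have hp := (hU.isPathConnected.joinedIn x hx y hy).somePath_mem
  have hq := (hU.isPathConnected.joinedIn y hy z hz).somePath_mem
  refine (hU.arrow_eq hx hz ((hU.isPathConnected.joinedIn x hx y hy).somePath.trans
    (hU.isPathConnected.joinedIn y hy z hz).somePath) fun t => ?_).symm
  rw [Path.trans_apply]
  split_ifs
  exacts [hp _, hq _]

theorem inv_arrow (hx : x ∈ U) (hy : y ∈ U) : inv (hU.arrow hx hy) = hU.arrow hy hx := by
  rw [IsIso.inv_eq_of_hom_inv_id]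
  rw [arrow_comp, arrow_self]

end IsSimplyConnected

end Groupoid

section Monodromy

variable {κ B F : Type*} [TopologicalSpace B] [TopologicalSpace F] [DiscreteTopology F]
  (Z : FiberBundleCore κ B F)

/-- The point of the fiber over `x` with coordinate `v` in the chart `i`. -/
def FiberBundleCore.fiberPoint (i : κ) (x : B) (v : F) : Z.proj ⁻¹' {x} :=
  ⟨⟨x, Z.coordChange i (Z.indexAt x) x v⟩, rfl⟩

theorem FiberBundleCore.isCoveringMap : IsCoveringMap Z.proj :=
  FiberBundle.isCoveringMap (F := F) (E := Z.Fiber)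

theorem FiberBundleCore.monodromy_fiberPoint (i : κ) {x y : B} (p : Path x y)
    (hp : ∀ t, p t ∈ Z.baseSet i) (v : F) :
    Z.isCoveringMap.monodromy (.mk p) (Z.fiberPoint i x v) = Z.fiberPoint i y v := by
  have hcont : Continuous fun t =>
      (Z.localTriv i).toOpenPartialHomeomorph.symm (p t, v) := by
    refine (Z.localTriv i).continuousOn_invFun.comp_continuous (by fun_prop) fun t => ?_
    exact (Z.mem_localTrivAsPartialEquiv_target i _).2 (hp t)
  let Γ : Path (Z.fiberPoint i x v).1 (Z.fiberPoint i y v).1 :=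
    { toFun := fun t => (Z.localTriv i).toOpenPartialHomeomorph.symm (p t, v)
      continuous_toFun := hcont
      source' := by simp [FiberBundleCore.fiberPoint]
      target' := by simp [FiberBundleCore.fiberPoint] }
  refine Z.isCoveringMap.monodromy_eq_of_map_eq (.mk Γ) ?_
  rfl

end Monodromy

section TwoCharts

/-- A cover of a space by two simply connected open sets whose intersection has path components
labelled by `Option ι`, together with a point in each of these components. -/
structure SimplyConnectedPair (X ι : Type*) [TopologicalSpace X] where
  U : Set X
  V : Set X
  isOpen_U : IsOpen U
  isOpen_V : IsOpen V
  simplyConnected_U : IsSimplyConnected U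
  simplyConnected_V : IsSimplyConnected V
  mem_or_mem : ∀ x, x ∈ U ∨ x ∈ V
  label : X → Option ι
  eventually_label : ∀ x ∈ U ∩ V, ∀ᶠ y in nhds x, label y = label x
  pt : Option ι → X
  pt_mem : ∀ o, pt o ∈ U ∩ V
  label_pt : ∀ o, label (pt o) = o
  joinedIn_pt : ∀ x ∈ U ∩ V, JoinedIn (U ∩ V) x (pt (label x))

namespace SimplyConnectedPair

variable {X ι : Type*} [TopologicalSpace X] (S : SimplyConnectedPair X ι)

/-- The loop going through `U` to the component labelled `o` and back through `V`. -/
noncomputable def loop (o : Option ι) : FundamentalGroup X (S.pt none) :=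
  S.simplyConnected_U.arrow (S.pt_mem none).1 (S.pt_mem o).1 ≫
    S.simplyConnected_V.arrow (S.pt_mem o).2 (S.pt_mem none).2

theorem loop_none : S.loop none = 1 := by
  rw [loop, IsSimplyConnected.arrow_self, IsSimplyConnected.arrow_self, Category.id_comp]
  rfl

/-- The homomorphism from the free group sending each generator to the corresponding loop. -/
noncomputable def ofFreeGroup : FreeGroup ι →* FundamentalGroup X (S.pt none) :=
  FreeGroup.lift fun i => S.loop (some i)

theorem loop_mem_range (o : Option ι) : S.loop o ∈ S.ofFreeGroup.range := by
  cases o with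
  | none => rw [S.loop_none]; exact one_mem _
  | some i => exact ⟨FreeGroup.of i, by simp [ofFreeGroup]⟩

theorem arrow_comp_arrow_mem_range {x : X} (hx : x ∈ S.U ∩ S.V) :
    (S.simplyConnected_U.arrow (S.pt_mem none).1 hx.1 ≫
      S.simplyConnected_V.arrow hx.2 (S.pt_mem none).2 : FundamentalGroup X (S.pt none)) ∈
      S.ofFreeGroup.range := by
  have hj := S.joinedIn_pt x hx
  have h : S.simplyConnected_U.arrow hx.1 (S.pt_mem (S.label x)).1 =
      S.simplyConnected_V.arrow hx.2 (S.pt_mem (S.label x)).2 := by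
    rw [S.simplyConnected_U.arrow_eq _ _ hj.somePath fun t => (hj.somePath_mem t).1,
      S.simplyConnected_V.arrow_eq _ _ hj.somePath fun t => (hj.somePath_mem t).2]
  convert! S.loop_mem_range (S.label x) using 1
  rw [loop, ← S.simplyConnected_U.arrow_comp (S.pt_mem none).1 hx.1 (S.pt_mem _).1, h,
    Category.assoc, S.simplyConnected_V.arrow_comp]

open Classical in
/-- A class of paths from the base point to `x`, inside `U` whenever `x` lies in `U`. -/
noncomputable def fromBase (x : X) :
    FundamentalGroupoid.mk (S.pt none) ⟶ FundamentalGroupoid.mk x :=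
  if h : x ∈ S.U then S.simplyConnected_U.arrow (S.pt_mem none).1 h
  else S.simplyConnected_V.arrow (S.pt_mem none).2 ((S.mem_or_mem x).resolve_left h)

theorem fromBase_comp_arrow_mem_range {x : X} (hx : x ∈ S.V) :
    (S.fromBase x ≫ S.simplyConnected_V.arrow hx (S.pt_mem none).2 :
      FundamentalGroup X (S.pt none)) ∈ S.ofFreeGroup.range := by
  by_cases h : x ∈ S.U
  · rw [fromBase, dif_pos h]
    exact S.arrow_comp_arrow_mem_range ⟨h, hx⟩
  · rw [fromBase, dif_neg h, S.simplyConnected_V.arrow_comp, S.simplyConnected_V.arrow_self]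
    exact one_mem _

theorem fromBase_of_mem {x : X} (h : x ∈ S.U) :
    S.fromBase x = S.simplyConnected_U.arrow (S.pt_mem none).1 h :=
  dif_pos h

/-- The loop at the base point obtained by completing a class of paths. -/
noncomputable def close {x y : X} (q : FundamentalGroupoid.mk x ⟶ FundamentalGroupoid.mk y) :
    FundamentalGroup X (S.pt none) :=
  S.fromBase x ≫ q ≫ inv (S.fromBase y)

theorem close_comp {x y z : X} (p : FundamentalGroupoid.mk x ⟶ FundamentalGroupoid.mk y)
    (q : FundamentalGroupoid.mk y ⟶ FundamentalGroupoid.mk z) :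
    S.close (p ≫ q) = S.close q * S.close p := by
  rw [End.mul_def]
  simp [close]

theorem close_mem_range {x y : X} (q : Path.Homotopic.Quotient x y) :
    S.close q ∈ S.ofFreeGroup.range := by
  refine Path.Homotopic.Quotient.induction_of_open_cover (c := fun i => bif i then S.U else S.V)
    (P := fun x y q => S.close q ∈ S.ofFreeGroup.range) ?_ ?_ ?_ ?_ q
  · rintro (_ | _)
    exacts [S.isOpen_V, S.isOpen_U]
  · intro x
    rcases S.mem_or_mem x with h | h
    exacts [⟨true, h⟩, ⟨false, h⟩]
  · intro x y z p q hp hq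
    exact (S.close_comp p q).symm ▸ mul_mem hq hp
  · rintro (_ | _) x y p hp
    · replace hp : ∀ t, p t ∈ S.V := hp
      have hx : x ∈ S.V := by simpa using hp 0
      have hy : y ∈ S.V := by simpa using hp 1
      rw [← S.simplyConnected_V.arrow_eq hx hy p hp]
      convert! mul_mem (inv_mem (S.fromBase_comp_arrow_mem_range hy))
        (S.fromBase_comp_arrow_mem_range hx) using 1
      rw [eq_inv_mul_iff_mul_eq, End.mul_def]
      simp [close, IsSimplyConnected.arrow_comp]
    · replace hp : ∀ t, p t ∈ S.U := hp
      have hx : x ∈ S.U := by simpa using hp 0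
      have hy : y ∈ S.U := by simpa using hp 1
      convert! one_mem S.ofFreeGroup.range using 1
      rw [← S.simplyConnected_U.arrow_eq hx hy p hp, End.one_def]
      simp [close, S.fromBase_of_mem, hx, hy, IsSimplyConnected.inv_arrow,
        IsSimplyConnected.arrow_comp, IsSimplyConnected.arrow_self]

theorem ofFreeGroup_surjective : Function.Surjective S.ofFreeGroup := by
  intro q
  have hb : S.fromBase (S.pt none) = 𝟙 _ := by
    rw [fromBase_of_mem _ (S.pt_mem none).1, IsSimplyConnected.arrow_self]
  have h : S.close q = q := by simp [close, hb]
  exact h ▸ S.close_mem_range q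

section Cover

variable {G : Type*} [Group G] [TopologicalSpace G] [DiscreteTopology G] (g : Option ι → G)

/-- The element of `G` describing the change of coordinates between two charts. -/
def transition : Bool → Bool → X → G
  | true, false, x => g (S.label x)
  | false, true, x => (g (S.label x))⁻¹
  | _, _, _ => 1

open Classical in
/-- The covering space with fiber `G` obtained by gluing trivial covers of `U` and `V` by means
of a function of the components of `U ∩ V`. -/
noncomputable def bundleCore : FiberBundleCore Bool X G where
  baseSet i := bif i then S.U else S.V
  isOpen_baseSet := by
    rintro (_ | _)
    exacts [S.isOpen_V, S.isOpen_U]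
  indexAt x := decide (x ∈ S.U)
  mem_baseSet_at x := by
    by_cases h : x ∈ S.U
    · simp [h]
    · simpa [h] using (S.mem_or_mem x).resolve_left h
  coordChange i j x v := S.transition g i j x * v
  coordChange_self := by
    rintro (_ | _) x - v <;> exact one_mul v
  continuousOn_coordChange := by
    have key : ∀ x ∈ S.U ∩ S.V, ∀ i j : Bool, ∀ᶠ y in nhds x,
        S.transition g i j y = S.transition g i j x := by
      intro x hx i j
      filter_upwards [S.eventually_label x hx] with y hy
      cases i <;> cases j <;> simp [transition, hy]
    rintro i j ⟨x, v⟩ ⟨hx, -⟩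
    have hloc : ∀ᶠ y in nhds x, S.transition g i j y = S.transition g i j x := by
      rcases i with _ | _ <;> rcases j with _ | _
      · simp [transition]
      · exact key x ⟨hx.2, hx.1⟩ _ _
      · exact key x ⟨hx.1, hx.2⟩ _ _
      · simp [transition]
    refine ContinuousAt.continuousWithinAt (ContinuousAt.congr
      (f := fun p : X × G => S.transition g i j x * p.2) ?_ ?_)
    · exact (continuous_of_discreteTopology (f := fun v : G => S.transition g i j x * v)).comp
        continuous_snd |>.continuousAt
    · filter_upwards [continuous_fst.continuousAt.eventually hloc] with p hp
      rw [hp]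
  coordChange_comp := by
    rintro (_ | _) (_ | _) (_ | _) x - v <;> simp [transition]

theorem fiberPoint_true_eq {x : X} (hx : x ∈ S.U ∩ S.V) (v : G) :
    (S.bundleCore g).fiberPoint true x v =
      (S.bundleCore g).fiberPoint false x (g (S.label x) * v) := by
  simp [FiberBundleCore.fiberPoint, bundleCore, hx.1, transition]

theorem monodromy_arrow_U {x y : X} (hx : x ∈ S.U) (hy : y ∈ S.U) (v : G) :
    (S.bundleCore g).isCoveringMap.monodromy (S.simplyConnected_U.arrow hx hy)
      ((S.bundleCore g).fiberPoint true x v) = (S.bundleCore g).fiberPoint true y v :=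
  (S.bundleCore g).monodromy_fiberPoint true _
    (S.simplyConnected_U.isPathConnected.joinedIn x hx y hy).somePath_mem v

theorem monodromy_arrow_V {x y : X} (hx : x ∈ S.V) (hy : y ∈ S.V) (v : G) :
    (S.bundleCore g).isCoveringMap.monodromy (S.simplyConnected_V.arrow hx hy)
      ((S.bundleCore g).fiberPoint false x v) = (S.bundleCore g).fiberPoint false y v :=
  (S.bundleCore g).monodromy_fiberPoint false _
    (S.simplyConnected_V.isPathConnected.joinedIn x hx y hy).somePath_mem v

theorem monodromy_loop (hg : g none = 1) (o : Option ι) (v : G) :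
    (S.bundleCore g).isCoveringMap.monodromyPerm (S.pt none) (S.loop o)
      ((S.bundleCore g).fiberPoint true (S.pt none) v) =
      (S.bundleCore g).fiberPoint true (S.pt none) (g o * v) := by
  rw [IsCoveringMap.coe_monodromyPerm, loop]
  refine ((S.bundleCore g).isCoveringMap.monodromy_trans_apply _ _ _).trans ?_
  rw [monodromy_arrow_U, fiberPoint_true_eq _ _ (S.pt_mem _), monodromy_arrow_V,
    fiberPoint_true_eq _ _ (S.pt_mem _), S.label_pt, S.label_pt, hg, one_mul]

end Cover

theorem ofFreeGroup_injective : Function.Injective S.ofFreeGroup := by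
  let _ : TopologicalSpace (FreeGroup ι) := ⊥
  have : DiscreteTopology (FreeGroup ι) := ⟨rfl⟩
  let g : Option ι → FreeGroup ι := fun o => o.elim 1 FreeGroup.of
  let e := (S.bundleCore g).fiberPoint true (S.pt none)
  let φ := (S.bundleCore g).isCoveringMap.monodromyPerm (S.pt none)
  have hof : ∀ (i : ι) (v : FreeGroup ι), φ (S.ofFreeGroup (FreeGroup.of i)) (e v) =
      e (FreeGroup.of i * v) := by
    intro i v
    rw [ofFreeGroup, FreeGroup.lift_apply_of]
    exact S.monodromy_loop g rfl (some i) v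
  have key : ∀ w v : FreeGroup ι, φ (S.ofFreeGroup w) (e v) = e (w * v) := by
    intro w
    induction w using FreeGroup.induction_on with
    | C1 =>
      intro v
      rw [map_one, map_one, Equiv.Perm.one_apply, one_mul]
    | of i => exact hof i
    | inv_of i ih =>
      intro v
      rw [map_inv, map_inv, Equiv.Perm.inv_eq_iff_eq, ih, mul_inv_cancel_left]
    | mul x y hx hy =>
      intro v
      rw [map_mul, map_mul, Equiv.Perm.mul_apply, hy, hx, mul_assoc]
  have he : Function.Injective e := by
    intro v w h
    simp only [e, FiberBundleCore.fiberPoint, bundleCore, (S.pt_mem none).1, decide_true,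
      transition, one_mul, Subtype.mk.injEq] at h
    exact eq_of_heq (Bundle.TotalSpace.mk.inj h).2
  rw [injective_iff_map_eq_one]
  intro w hw
  have h := key w 1
  rw [hw, map_one, Equiv.Perm.one_apply, mul_one] at h
  exact (he h).symm

/-- The fundamental group of a space covered by two simply connected open sets is free on the
components of their intersection other than that of the base point. -/
noncomputable def freeGroupEquiv : FreeGroup ι ≃* FundamentalGroup X (S.pt none) :=
  MulEquiv.ofBijective S.ofFreeGroup ⟨S.ofFreeGroup_injective, S.ofFreeGroup_surjective⟩

theorem pathConnectedSpace (S : SimplyConnectedPair X ι) : PathConnectedSpace X := by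
  have h : ∀ x, Joined (S.pt none) x := fun x => by
    rcases S.mem_or_mem x with hx | hx
    · exact (S.simplyConnected_U.isPathConnected.joinedIn _ (S.pt_mem none).1 x hx).joined
    · exact (S.simplyConnected_V.isPathConnected.joinedIn _ (S.pt_mem none).2 x hx).joined
  exact ⟨⟨S.pt none⟩, fun x y => (h x).symm.trans (h y)⟩

end SimplyConnectedPair

end TwoCharts

section Homeomorphisms

/-- The homeomorphism of the plane shearing vertical lines. -/
def Homeomorph.shear (f : ℝ → ℝ) (hf : Continuous f) : ℝ × ℝ ≃ₜ ℝ × ℝ where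
  toFun p := (p.1, p.2 + f p.1)
  invFun p := (p.1, p.2 - f p.1)
  left_inv p := by simp
  right_inv p := by simp
  continuous_toFun := by fun_prop
  continuous_invFun := by fun_prop

theorem exists_continuous_interpolation {n : ℕ} {v : Fin n → ℝ} (hv : Function.Injective v)
    (r : Fin n → ℝ) : ∃ f : ℝ → ℝ, Continuous f ∧ ∀ j, f (v j) = r j :=
  ⟨fun x => (Lagrange.interpolate Finset.univ v r).eval x, Polynomial.continuous _, fun j =>
    Lagrange.eval_interpolate_at_node r hv.injOn (Finset.mem_univ j)⟩

theorem exists_injective_shear {n : ℕ} {k : Fin n → ℝ × ℝ} (hk : Function.Injective k) :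
    ∃ c : ℝ, Function.Injective fun j => (k j).2 + c * (k j).1 := by
  have hfin : (⋃ i, ⋃ j, ⋃ _ : i ≠ j,
      {c : ℝ | (k i).2 + c * (k i).1 = (k j).2 + c * (k j).1}).Finite := by
    refine finite_iUnion fun i => finite_iUnion fun j => finite_iUnion fun hij => ?_
    refine Set.Subsingleton.finite fun c hc d hd => ?_
    simp only [mem_ofPred_eq] at hc hd
    by_contra hcd
    have h1 : (k i).1 = (k j).1 := by
      have : (c - d) * ((k i).1 - (k j).1) = 0 := by linear_combination hc - hd
      rcases mul_eq_zero.1 this with h | h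
      exacts [absurd (sub_eq_zero.1 h) hcd, sub_eq_zero.1 h]
    rw [h1] at hc
    exact hij (hk (Prod.ext h1 (add_right_cancel hc)))
  obtain ⟨c, hc⟩ := hfin.exists_notMem
  refine ⟨c, fun i j hij => ?_⟩
  by_contra hne
  exact hc (mem_iUnion.2 ⟨i, mem_iUnion.2 ⟨j, mem_iUnion.2 ⟨hne, hij⟩⟩⟩)

/-- Any `n` distinct points of the plane can be moved to `(0, 0), …, (n - 1, 0)` by a
homeomorphism. -/
theorem exists_homeomorph_apply_eq {n : ℕ} {k : Fin n → ℝ × ℝ} (hk : Function.Injective k) :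
    ∃ e : ℝ × ℝ ≃ₜ ℝ × ℝ, ∀ j, e (k j) = (((j : ℕ) : ℝ), 0) := by
  obtain ⟨c, hc⟩ := exists_injective_shear hk
  obtain ⟨g, hg, hgk⟩ := exists_continuous_interpolation hc fun j => ((j : ℕ) : ℝ) - (k j).1
  obtain ⟨f, hf, hfk⟩ := exists_continuous_interpolation (v := fun j : Fin n => ((j : ℕ) : ℝ))
    (fun i j h => Fin.ext (Nat.cast_injective h)) fun j => -((k j).2 + c * (k j).1)
  refine ⟨(Homeomorph.shear (fun x => c * x) (by fun_prop)).trans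
    ((Homeomorph.prodComm ℝ ℝ).trans ((Homeomorph.shear g hg).trans
      ((Homeomorph.prodComm ℝ ℝ).trans (Homeomorph.shear f hf)))), fun j => ?_⟩
  simp only [Homeomorph.shear, Homeomorph.trans_apply, Homeomorph.homeomorph_mk_coe,
    Equiv.coe_fn_mk, Homeomorph.coe_prodComm, Prod.swap_prod_mk, hgk, add_sub_cancel, hfk,
    add_neg_cancel]

end Homeomorphisms

section PuncturedPlane

/-- The points of the plane not lying on the vertical half-lines going up from
`(0, 0), …, (n - 1, 0)`. -/
def lowerSlit (n : ℕ) : Set (ℝ × ℝ) := {p | p.2 < 0 ∨ ∀ j < n, p.1 ≠ j}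

/-- The points of the plane not lying on the vertical half-lines going down from
`(0, 0), …, (n - 1, 0)`. -/
def upperSlit (n : ℕ) : Set (ℝ × ℝ) := {p | 0 < p.2 ∨ ∀ j < n, p.1 ≠ j}

theorem isSimplyConnected_lowerSlit (n : ℕ) : IsSimplyConnected (lowerSlit n) := by
  suffices h : ContractibleSpace (lowerSlit n) by
    rw [IsSimplyConnected]
    infer_instance
  rw [contractible_iff_id_nullhomotopic]
  let r : C(lowerSlit n, lowerSlit n) :=
    ⟨fun p => ⟨(p.1.1, min p.1.2 (-1)), Or.inl ((min_le_right _ _).trans_lt (by norm_num))⟩,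
      by fun_prop⟩
  let H₁ : (ContinuousMap.id (lowerSlit n)).Homotopy r :=
    { toFun := fun q => ⟨(q.2.1.1, q.2.1.2 - q.1 * max 0 (q.2.1.2 + 1)), by
        have h : 0 ≤ (q.1 : ℝ) * max 0 (q.2.1.2 + 1) :=
          mul_nonneg q.1.2.1 (le_max_left _ _)
        exact q.2.2.imp (fun h' => by simp only; linarith) id⟩
      continuous_toFun := by fun_prop
      map_zero_left := fun p => by simp
      map_one_left := fun p => by
        refine Subtype.ext (Prod.ext rfl ?_)
        simp only [r, Set.Icc.coe_one, one_mul, ContinuousMap.coe_mk]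
        rcases le_total p.1.2 (-1) with h | h
        · rw [min_eq_left h, max_eq_left (by linarith), sub_zero]
        · rw [min_eq_right h, max_eq_right (by linarith)]
          ring }
  let H₂ : r.Homotopy (ContinuousMap.const _ ⟨(0, -1), Or.inl (by norm_num)⟩) :=
    { toFun := fun q => ⟨((1 - q.1) * q.2.1.1, (1 - q.1) * min q.2.1.2 (-1) - q.1), by
        left
        have h1 : (1 - (q.1 : ℝ)) * min q.2.1.2 (-1) ≤ (1 - q.1) * (-1) :=
          mul_le_mul_of_nonneg_left (min_le_right _ _) (by linarith [q.1.2.2])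
        simp only
        linarith⟩
      continuous_toFun := by fun_prop
      map_zero_left := fun p => by simp [r]
      map_one_left := fun p => by simp }
  exact ⟨_, ⟨H₁.trans H₂⟩⟩

theorem isSimplyConnected_upperSlit (n : ℕ) : IsSimplyConnected (upperSlit n) := by
  have h : upperSlit n =
      ((Homeomorph.refl ℝ).prodCongr (Homeomorph.neg ℝ)) ⁻¹' lowerSlit n := by
    ext p
    simp [upperSlit, lowerSlit]
  rw [h, Homeomorph.isSimplyConnected_preimage]
  exact isSimplyConnected_lowerSlit n

theorem lowerSlit_inter_upperSlit (n : ℕ) :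
    lowerSlit n ∩ upperSlit n = {p : ℝ × ℝ | ∀ j < n, p.1 ≠ j} := by
  ext p
  refine ⟨?_, fun h => ⟨Or.inr h, Or.inr h⟩⟩
  rintro ⟨h | h, h' | h'⟩
  exacts [absurd h h'.not_gt, h', h, h]

theorem isOpen_forall_ne_natCast (n : ℕ) : IsOpen {p : ℝ × ℝ | ∀ j < n, p.1 ≠ j} := by
  have h : {p : ℝ × ℝ | ∀ j < n, p.1 ≠ j} = ⋂ j ∈ Iio n, {p : ℝ × ℝ | p.1 ≠ (j : ℝ)} := by
    ext p
    simp
  rw [h]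
  exact (finite_Iio n).isOpen_biInter fun j _ => isOpen_ne_fun continuous_fst continuous_const

theorem isOpen_lowerSlit (n : ℕ) : IsOpen (lowerSlit n) :=
  (isOpen_lt continuous_snd continuous_const).union (isOpen_forall_ne_natCast n)

theorem isOpen_upperSlit (n : ℕ) : IsOpen (upperSlit n) :=
  (isOpen_lt continuous_const continuous_snd).union (isOpen_forall_ne_natCast n)

/-- The index of the vertical strip containing a point of abscissa `x`. -/
noncomputable def stripIndex (n : ℕ) (x : ℝ) : Fin (n + 1) :=
  ⟨min ⌈x⌉₊ n, by omega⟩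

theorem stripIndex_eq_iff {n : ℕ} {x y : ℝ} :
    stripIndex n x = stripIndex n y ↔ ∀ j < n, ((j : ℝ) < x ↔ (j : ℝ) < y) := by
  have h : ∀ a b : ℕ, min a n = min b n ↔ ∀ j < n, (j < a ↔ j < b) := by
    intro a b
    refine ⟨fun h j hj => by omega, fun h => ?_⟩
    by_contra hne
    have := h (min a b) (by omega)
    omega
  simp [stripIndex, Fin.ext_iff, h, Nat.lt_ceil]

theorem stripIndex_sub_half {n : ℕ} (k : Fin (n + 1)) :
    stripIndex n ((k : ℕ) - 1 / 2) = k := by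
  have h : ⌈((k : ℕ) : ℝ) - 1 / 2⌉₊ = (k : ℕ) := by
    rcases Nat.eq_zero_or_pos (k : ℕ) with h0 | h0
    · rw [h0, Nat.ceil_eq_zero]
      norm_num
    · rw [Nat.ceil_eq_iff h0.ne', Nat.cast_sub h0, Nat.cast_one]
      constructor <;> linarith
  ext
  simp only [stripIndex, h]
  omega

theorem natCast_sub_half_ne (k j : ℕ) : (k : ℝ) - 1 / 2 ≠ j := by
  intro h
  have : ((2 * k : ℕ) : ℝ) = ((2 * j + 1 : ℕ) : ℝ) := by
    push_cast
    linarith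
  have := Nat.cast_injective this
  omega

theorem joinedIn_of_stripIndex_eq {n : ℕ} {p q : ℝ × ℝ} (hp : ∀ j < n, p.1 ≠ j)
    (hq : ∀ j < n, q.1 ≠ j) (h : stripIndex n p.1 = stripIndex n q.1) :
    JoinedIn {p : ℝ × ℝ | ∀ j < n, p.1 ≠ j} p q := by
  rw [stripIndex_eq_iff] at h
  refine JoinedIn.of_segment_subset fun z hz j hj => ?_
  have hfst : IsLinearMap ℝ (Prod.fst : ℝ × ℝ → ℝ) := ⟨fun _ _ => rfl, fun _ _ => rfl⟩
  rcases lt_or_gt_of_ne (hp j hj) with hpj | hpj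
  · have hqj : q.1 < j :=
      lt_of_le_of_ne (not_lt.1 fun h' => hpj.not_gt ((h j hj).2 h')) (hq j hj)
    exact ((convex_halfSpace_lt hfst (j : ℝ)).segment_subset hpj hqj hz).ne
  · exact ((convex_halfSpace_gt hfst (j : ℝ)).segment_subset hpj ((h j hj).1 hpj) hz).ne'

theorem JoinedIn.preimage_subtypeVal {X : Type*} [TopologicalSpace X] {s t : Set X} (hts : t ⊆ s)
    {x y : s} (h : JoinedIn t (x : X) y) : JoinedIn (Subtype.val ⁻¹' t) x y :=
  ⟨{ toFun := fun r => ⟨h.somePath r, hts (h.somePath_mem r)⟩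
     source' := by simp
     target' := by simp }, h.somePath_mem⟩

theorem IsSimplyConnected.preimage_subtypeVal {X : Type*} [TopologicalSpace X] {s t : Set X}
    (hts : t ⊆ s) (ht : IsSimplyConnected t) :
    IsSimplyConnected (Subtype.val ⁻¹' t : Set s) := by
  rwa [← Topology.IsEmbedding.subtypeVal.isSimplyConnected_image, Subtype.image_preimage_coe,
    inter_eq_right.2 hts]

/-- The plane without the points `(0, 0), …, (n - 1, 0)`. -/
def puncturedPlane (n : ℕ) : Set (ℝ × ℝ) := (range fun j : Fin n => (((j : ℕ) : ℝ), (0 : ℝ)))ᶜ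

theorem mem_puncturedPlane {n : ℕ} {p : ℝ × ℝ} :
    p ∈ puncturedPlane n ↔ p ∈ lowerSlit n ∨ p ∈ upperSlit n := by
  constructor
  · intro hp
    rcases lt_trichotomy p.2 0 with h | h | h
    · exact Or.inl (Or.inl h)
    · exact Or.inl (Or.inr fun j hj hpj => hp ⟨⟨j, hj⟩, Prod.ext hpj.symm h.symm⟩)
    · exact Or.inr (Or.inl h)
  · rintro ((h | h) | (h | h)) ⟨j, rfl⟩
    exacts [lt_irrefl _ h, h j j.2 rfl, lt_irrefl _ h, h j j.2 rfl]

theorem lowerSlit_subset_puncturedPlane (n : ℕ) : lowerSlit n ⊆ puncturedPlane n :=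
  fun _ hp => mem_puncturedPlane.2 (Or.inl hp)

theorem upperSlit_subset_puncturedPlane (n : ℕ) : upperSlit n ⊆ puncturedPlane n :=
  fun _ hp => mem_puncturedPlane.2 (Or.inr hp)

theorem sub_half_mem_slits {n : ℕ} (k : Fin (n + 1)) :
    (((k : ℕ) : ℝ) - 1 / 2, (0 : ℝ)) ∈ lowerSlit n ∩ upperSlit n := by
  rw [lowerSlit_inter_upperSlit]
  exact fun j _ => natCast_sub_half_ne k j

/-- The cover of the punctured plane by the two slit planes. -/
noncomputable def puncturedPlaneCover (n : ℕ) :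
    SimplyConnectedPair (puncturedPlane n) (Fin n) where
  U := Subtype.val ⁻¹' lowerSlit n
  V := Subtype.val ⁻¹' upperSlit n
  isOpen_U := (isOpen_lowerSlit n).preimage continuous_subtype_val
  isOpen_V := (isOpen_upperSlit n).preimage continuous_subtype_val
  simplyConnected_U :=
    (isSimplyConnected_lowerSlit n).preimage_subtypeVal (lowerSlit_subset_puncturedPlane n)
  simplyConnected_V :=
    (isSimplyConnected_upperSlit n).preimage_subtypeVal (upperSlit_subset_puncturedPlane n)
  mem_or_mem p := mem_puncturedPlane.1 p.2
  label p := finSuccEquiv n (stripIndex n p.1.1)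
  eventually_label p hp := by
    rw [← preimage_inter, lowerSlit_inter_upperSlit] at hp
    simp only [EmbeddingLike.apply_eq_iff_eq, stripIndex_eq_iff]
    have hcont : Continuous fun q : puncturedPlane n => q.1.1 := by fun_prop
    refine (Filter.eventually_all_finite (finite_Iio n)).2 fun j hj => ?_
    rcases lt_or_gt_of_ne (hp j hj) with h | h
    · filter_upwards [hcont.continuousAt.eventually_lt continuousAt_const h] with q hq
      exact iff_of_false hq.not_gt h.not_gt
    · filter_upwards [continuousAt_const.eventually_lt hcont.continuousAt h] with q hq
      exact iff_of_true hq h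
  pt o := ⟨((((finSuccEquiv n).symm o : ℕ) : ℝ) - 1 / 2, 0),
    lowerSlit_subset_puncturedPlane n (sub_half_mem_slits _).1⟩
  pt_mem o := sub_half_mem_slits _
  label_pt o := by
    rw [stripIndex_sub_half, Equiv.apply_symm_apply]
  joinedIn_pt p hp := by
    rw [← preimage_inter] at hp ⊢
    refine JoinedIn.preimage_subtypeVal
      (inter_subset_left.trans (lowerSlit_subset_puncturedPlane n)) ?_
    rw [lowerSlit_inter_upperSlit] at hp ⊢
    refine joinedIn_of_stripIndex_eq hp
      (q := ((((finSuccEquiv n).symm (finSuccEquiv n (stripIndex n p.1.1)) : ℕ) : ℝ) - 1 / 2, 0))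
      (fun j _ => natCast_sub_half_ne _ j) ?_
    rw [stripIndex_sub_half, Equiv.symm_apply_apply]

end PuncturedPlane

section Transport

/-- Homeomorphic spaces have isomorphic fundamental groups. -/
theorem Homeomorph.nonempty_fundamentalGroup_mulEquiv {X Y : Type} [TopologicalSpace X]
    [TopologicalSpace Y] [PathConnectedSpace Y] (h : X ≃ₜ Y) (x : X) (y : Y) :
    Nonempty (FundamentalGroup X x ≃* FundamentalGroup Y y) :=
  let E : FundamentalGroupoid X ≌ FundamentalGroupoid Y :=
    FundamentalGroupoidFunctor.equivOfHomotopyEquiv h.toHomotopyEquiv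
  let φ : FundamentalGroup X x ≃* FundamentalGroup Y (h x) :=
    E.fullyFaithfulFunctor.mulEquivEnd (FundamentalGroupoid.mk x)
  ⟨φ.trans (FundamentalGroup.fundamentalGroupMulEquivOfPathConnected _ y)⟩

/-- The disk without `n` points is homeomorphic to the plane without `n` points. -/
theorem nonempty_homeomorph_puncturedPlane {K : Set ℂ} {n : ℕ}
    (hK : K ⊆ Metric.ball (0 : ℂ) 1) (hfin : K.Finite) (hcard : K.ncard = n) :
    Nonempty (↥(Metric.ball (0 : ℂ) 1 \ K) ≃ₜ puncturedPlane n) := by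
  have := hfin.to_subtype
  let k : Fin n ≃ K := (Finite.equivFinOfCardEq ((Nat.card_coe_set_eq K).trans hcard)).symm
  let e₀ : Metric.ball (0 : ℂ) 1 ≃ₜ ℝ × ℝ :=
    Homeomorph.unitBall.symm.trans Complex.equivRealProdCLM.toHomeomorph
  obtain ⟨e₁, he₁⟩ := exists_homeomorph_apply_eq (k := fun j => e₀ ⟨k j, hK (k j).2⟩)
    fun i j hij => k.injective (Subtype.ext (Subtype.mk.inj (e₀.injective hij)))
  let e := e₀.trans e₁
  have he : ∀ z : Metric.ball (0 : ℂ) 1, e z ∈ puncturedPlane n ↔ (z : ℂ) ∉ K := by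
    refine fun z => not_congr ⟨?_, fun hz => ⟨k.symm ⟨z, hz⟩, ?_⟩⟩
    · rintro ⟨j, hj⟩
      have : (⟨k j, hK (k j).2⟩ : Metric.ball (0 : ℂ) 1) = z :=
        e.injective ((he₁ j).trans hj)
      exact this ▸ (k j).2
    · refine (he₁ _).symm.trans ?_
      simp [e]
  exact ⟨{
    toFun := fun z => ⟨e ⟨z, z.2.1⟩, (he _).2 z.2.2⟩
    invFun := fun p => ⟨e.symm p, (e.symm p).2, (he _).1 (by simp)⟩
    left_inv := fun z => by simp
    right_inv := fun p => by simp
    continuous_toFun := by fun_prop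
    continuous_invFun := by fun_prop }⟩

end Transport

/-- If `K` is a finite subset of the open unit disk `B` with exactly `n`
elements and `u ∈ B ∖ K`, then `π₁(B ∖ K, u)` is isomorphic to the free group on `n`
generators. -/
theorem stmt11 (K : Set ℂ) (n : ℕ) (hK : K ⊆ Metric.ball (0 : ℂ) 1) (hfin : K.Finite)
    (hcard : K.ncard = n) (u : ℂ) (hu : u ∈ Metric.ball (0 : ℂ) 1 \ K) :
    Nonempty (FundamentalGroup (↥(Metric.ball (0 : ℂ) 1 \ K))
      (⟨u, hu⟩ : ↥(Metric.ball (0 : ℂ) 1 \ K)) ≃* FreeGroup (Fin n)) := by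
  obtain ⟨h⟩ := nonempty_homeomorph_puncturedPlane hK hfin hcard
  have := (puncturedPlaneCover n).pathConnectedSpace
  obtain ⟨φ⟩ := h.nonempty_fundamentalGroup_mulEquiv ⟨u, hu⟩ ((puncturedPlaneCover n).pt none)
  exact ⟨φ.trans (puncturedPlaneCover n).freeGroupEquiv.symm⟩
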